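/- arXiv:2110.00537 — 4 statements merged into one kernel-verified Lean document; each statement's English description precedes it below -/
import Mathlib

section
/- Let W₁, W₂, T be symmetric positive definite real n×n matrices. Then the iteration matrix B = (W₂ - iT)^{-1} W₁ (W₁ + iT)^{-1} W₂ has spectral radius strictly less than 1; consequently the stationary iteration x^{(k+1)} = B x^{(k)} - g converges to the unique fixed point for any initial vector x^{(0)}. -/
/-- complexification of a real matrix -/
def Matrix.cplx {n : ℕ} (A : Matrix (Fin n) (Fin n) ℝ) : Matrix (Fin n) (Fin n) ℂ :=
  A.map Complex.ofReal

open scoped ComplexOrder in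
/-- The complexification of a real positive definite matrix is positive definite. -/
theorem Matrix.posDef_cplx {n : ℕ} {A : Matrix (Fin n) (Fin n) ℝ} (hA : A.PosDef) :
    A.cplx.PosDef := by
  have hH : A.cplx.IsHermitian := by
    ext i j
    simpa [Matrix.cplx] using hA.isHermitian.apply i j
  refine Matrix.PosDef.of_dotProduct_mulVec_pos hH fun x hx => ?_
  have him : (star x ⬝ᵥ A.cplx.mulVec x).im = 0 := hH.im_star_dotProduct_mulVec_self x
  have hre : (star x ⬝ᵥ A.cplx.mulVec x).re =
      star (fun i => (x i).re) ⬝ᵥ A.mulVec (fun i => (x i).re) +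
      star (fun i => (x i).im) ⬝ᵥ A.mulVec (fun i => (x i).im) := by
    simp [dotProduct, Matrix.mulVec, Matrix.cplx, Finset.sum_add_distrib]
  have hx' : (fun i => (x i).re) ≠ 0 ∨ (fun i => (x i).im) ≠ 0 := by
    by_contra! h
    exact hx (funext fun i => Complex.ext (congrFun h.1 i) (congrFun h.2 i))
  rw [Complex.lt_def]
  refine ⟨?_, him.symm⟩
  rw [hre, Complex.zero_re]
  rcases hx' with h | h
  · exact add_pos_of_pos_of_nonneg (hA.dotProduct_mulVec_pos h)
      (hA.posSemidef.dotProduct_mulVec_nonneg _)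
  · exact add_pos_of_nonneg_of_pos (hA.posSemidef.dotProduct_mulVec_nonneg _)
      (hA.dotProduct_mulVec_pos h)

open scoped Matrix ComplexOrder in
/-- In the inner product weighted by `T⁻¹`, the vectors `W u` and `c T u` are orthogonal
for imaginary units `c`. -/
theorem Matrix.weighted_form_add_smul {n : ℕ} {W T : Matrix (Fin n) (Fin n) ℂ}
    (hW : W.IsHermitian) (hT : T.PosDef) {c : ℂ} (hc : star c = -c) (hcc : c * c = -1)
    (u : Fin n → ℂ) :
    star ((W + c • T).mulVec u) ⬝ᵥ T⁻¹.mulVec ((W + c • T).mulVec u) =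
      star (W.mulVec u) ⬝ᵥ T⁻¹.mulVec (W.mulVec u) + star u ⬝ᵥ T.mulVec u := by
  have hdet : IsUnit T.det := (Matrix.isUnit_iff_isUnit_det T).1 hT.isUnit
  have key : (W + c • T)ᴴ * (T⁻¹ * (W + c • T)) = Wᴴ * (T⁻¹ * W) + T := by
    rw [Matrix.conjTranspose_add, Matrix.conjTranspose_smul, hT.isHermitian.eq, hW.eq, hc]
    simp only [mul_add, add_mul, Matrix.mul_smul, Matrix.smul_mul, Matrix.nonsing_inv_mul _ hdet,
      Matrix.mul_nonsing_inv_cancel_left _ _ hdet, mul_one, smul_smul]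
    rw [mul_neg, hcc]
    simp only [neg_smul, neg_neg, one_smul]
    abel
  simp only [Matrix.star_mulVec, ← Matrix.dotProduct_mulVec, Matrix.mulVec_mulVec, key]
  rw [Matrix.add_mulVec, dotProduct_add]

open scoped ComplexOrder in
theorem Matrix.PosDef.isUnit_add_smul {n : ℕ} {W T : Matrix (Fin n) (Fin n) ℂ}
    (hW : W.IsHermitian) (hT : T.PosDef) {c : ℂ} (hc : star c = -c) (hcc : c * c = -1) :
    IsUnit (W + c • T).det := by
  rw [isUnit_iff_ne_zero]
  intro h
  obtain ⟨u, hu, hu0⟩ := Matrix.exists_mulVec_eq_zero_iff.2 h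
  have hq := Matrix.weighted_form_add_smul hW hT hc hcc u
  rw [hu0, Matrix.mulVec_zero, dotProduct_zero] at hq
  exact (add_pos_of_nonneg_of_pos (hT.inv.posSemidef.dotProduct_mulVec_nonneg _)
    (hT.dotProduct_mulVec_pos hu)).ne hq

open scoped ComplexOrder in
theorem Matrix.norm_lt_one_of_mem_spectrum_splitting {n : ℕ}
    {W₁ W₂ T : Matrix (Fin n) (Fin n) ℂ} (hW₁ : W₁.IsHermitian) (hW₂ : W₂.IsHermitian)
    (hT : T.PosDef) {lam : ℂ}
    (hlam : lam ∈ spectrum ℂ ((W₂ - Complex.I • T)⁻¹ * W₁ * (W₁ + Complex.I • T)⁻¹ * W₂)) :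
    ‖lam‖ < 1 := by
  have hI : star Complex.I = -Complex.I := Complex.conj_I
  have hnI : star (-Complex.I) = -(-Complex.I) := by simp
  have hnII : -Complex.I * -Complex.I = -1 := by simp
  rw [sub_eq_add_neg, ← neg_smul, ← Matrix.spectrum_toLin',
    ← Module.End.hasEigenvalue_iff_mem_spectrum] at hlam
  obtain ⟨v, hv⟩ := hlam.exists_hasEigenvector
  have hv0 := hv.2
  have hBv := hv.apply_eq_smul
  rw [Matrix.toLin'_apply] at hBv
  have hd₁ := Matrix.PosDef.isUnit_add_smul hW₁ hT hI Complex.I_mul_I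
  have hd₂ := Matrix.PosDef.isUnit_add_smul hW₂ hT hnI hnII
  obtain ⟨u, hu⟩ : ∃ u, u = ((W₁ + Complex.I • T)⁻¹ * W₂).mulVec v := ⟨_, rfl⟩
  have hu₁ : (W₁ + Complex.I • T).mulVec u = W₂.mulVec v := by
    rw [hu, Matrix.mulVec_mulVec, Matrix.mul_nonsing_inv_cancel_left _ _ hd₁]
  have hu₂ : W₁.mulVec u = lam • (W₂ + -Complex.I • T).mulVec v := by
    rw [← Matrix.mulVec_smul, ← hBv, hu, Matrix.mulVec_mulVec, Matrix.mulVec_mulVec]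
    simp only [mul_assoc]
    rw [Matrix.mul_nonsing_inv_cancel_left _ _ hd₂]
  have h₁ := congrArg Complex.re (Matrix.weighted_form_add_smul hW₁ hT hI Complex.I_mul_I u)
  have h₂ := congrArg Complex.re (Matrix.weighted_form_add_smul hW₂ hT hnI hnII v)
  have h₃ : (star (W₁.mulVec u) ⬝ᵥ T⁻¹.mulVec (W₁.mulVec u)).re = ‖lam‖ ^ 2 *
      (star ((W₂ + -Complex.I • T).mulVec v) ⬝ᵥ
        T⁻¹.mulVec ((W₂ + -Complex.I • T).mulVec v)).re := by
    rw [hu₂, star_smul, Matrix.mulVec_smul, smul_dotProduct, dotProduct_smul, smul_smul,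
      smul_eq_mul, ← Complex.re_ofReal_mul]
    congr 2
    rw [Complex.star_def, Complex.conj_mul', Complex.ofReal_pow]
  rw [hu₁, Complex.add_re] at h₁
  rw [Complex.add_re] at h₂
  have hs := (Complex.le_def.1 (hT.posSemidef.dotProduct_mulVec_nonneg u)).1
  have ht := (Complex.lt_def.1 (hT.dotProduct_mulVec_pos hv0)).1
  have hb := (Complex.le_def.1 (hT.inv.posSemidef.dotProduct_mulVec_nonneg (W₂.mulVec v))).1
  rw [Complex.zero_re] at hs ht hb
  by_contra! hge
  rw [h₂] at h₃
  nlinarith [one_le_pow₀ hge (n := 2)]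

/-- In a complex Banach algebra, the powers of an element whose spectrum lies in the open unit
disc tend to zero. -/
theorem tendsto_pow_atTop_nhds_zero_of_forall_spectrum_norm_lt_one {A : Type*} [NormedRing A]
    [NormedAlgebra ℂ A] [CompleteSpace A] {a : A} (h : ∀ z ∈ spectrum ℂ a, ‖z‖ < 1) :
    Filter.Tendsto (fun k : ℕ => a ^ k) Filter.atTop (nhds 0) := by
  nontriviality A
  have hr : spectralRadius ℂ a < 1 := by
    simpa using spectrum.spectralRadius_lt_of_forall_lt a (r := 1) fun z hz => h z hz
  obtain ⟨r, har, hr1⟩ := ENNReal.lt_iff_exists_nnreal_btwn.1 hr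
  have hr1' : r < 1 := by exact_mod_cast hr1
  refine squeeze_zero_norm' ?_ (tendsto_pow_atTop_nhds_zero_of_lt_one r.2 (by exact_mod_cast hr1'))
  filter_upwards [(spectrum.pow_nnnorm_pow_one_div_tendsto_nhds_spectralRadius a).eventually_lt_const
    har, Filter.eventually_gt_atTop 0] with k hk hk0
  have hk0' : (0 : ℝ) < k := by exact_mod_cast hk0
  rw [one_div, ENNReal.rpow_inv_lt_iff hk0', ENNReal.rpow_natCast] at hk
  exact_mod_cast hk.le

attribute [local instance] Matrix.linftyOpNormedRing Matrix.linftyOpNormedAlgebra in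
theorem Matrix.tendsto_pow_mulVec_zero {n : ℕ} {B : Matrix (Fin n) (Fin n) ℂ}
    (h : ∀ z ∈ spectrum ℂ B, ‖z‖ < 1) (v : Fin n → ℂ) :
    Filter.Tendsto (fun k : ℕ => (B ^ k).mulVec v) Filter.atTop (nhds 0) := by
  have hB := tendsto_pow_atTop_nhds_zero_of_forall_spectrum_norm_lt_one h
  have hc : Continuous fun M : Matrix (Fin n) (Fin n) ℂ => M.mulVec v := by fun_prop
  simpa only [Matrix.zero_mulVec, Function.comp_def] using (hc.tendsto 0).comp hB


/-- Theorem 1: the Method I iteration matrix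
`B = (W₂ - iT)⁻¹ W₁ (W₁ + iT)⁻¹ W₂` has spectral radius `< 1`, and the stationary
iteration `x^{(k+1)} = B x^{(k)} - g` converges to the unique fixed point for any
initial vector. -/
theorem stmt_2 {n : ℕ} (W₁ W₂ T : Matrix (Fin n) (Fin n) ℝ)
    (hW₁ : W₁.PosDef) (hW₂ : W₂.PosDef) (hT : T.PosDef)
    (B : Matrix (Fin n) (Fin n) ℂ)
    (hB : B = (W₂.cplx - Complex.I • T.cplx)⁻¹ * W₁.cplx *
      (W₁.cplx + Complex.I • T.cplx)⁻¹ * W₂.cplx) :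
    (∀ lam ∈ spectrum ℂ B, ‖lam‖ < 1) ∧
    ∀ g x₀ : Fin n → ℂ, ∃ xstar : Fin n → ℂ,
      xstar = B.mulVec xstar - g ∧
      (∀ y : Fin n → ℂ, y = B.mulVec y - g → y = xstar) ∧
      ∀ x : ℕ → Fin n → ℂ, x 0 = x₀ → (∀ k, x (k + 1) = B.mulVec (x k) - g) →
        Filter.Tendsto x Filter.atTop (nhds xstar) := by
  have hspec : ∀ lam ∈ spectrum ℂ B, ‖lam‖ < 1 := open scoped ComplexOrder in fun lam hlam =>
    Matrix.norm_lt_one_of_mem_spectrum_splitting (Matrix.posDef_cplx hW₁).isHermitian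
      (Matrix.posDef_cplx hW₂).isHermitian (Matrix.posDef_cplx hT) (hB ▸ hlam)
  refine ⟨hspec, fun g x₀ => ?_⟩
  have hdet : IsUnit (1 - B) := by
    have h1 : (1 : ℂ) ∉ spectrum ℂ B := fun h => by simpa using hspec 1 h
    simpa [spectrum.notMem_iff] using h1
  rw [Matrix.isUnit_iff_isUnit_det] at hdet
  have hfix : ∀ y : Fin n → ℂ, y = B.mulVec y - g ↔ (1 - B).mulVec y = -g := fun y => by
    rw [Matrix.sub_mulVec, Matrix.one_mulVec, sub_eq_iff_eq_add', sub_eq_add_neg]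
  have hstar : (1 - B).mulVec ((1 - B)⁻¹.mulVec (-g)) = -g := by
    rw [Matrix.mulVec_mulVec, Matrix.mul_nonsing_inv _ hdet, Matrix.one_mulVec]
  refine ⟨(1 - B)⁻¹.mulVec (-g), (hfix _).2 hstar, fun y hy => ?_, fun x _ hx => ?_⟩
  · rw [← (hfix y).1 hy, Matrix.mulVec_mulVec, Matrix.nonsing_inv_mul _ hdet, Matrix.one_mulVec]
  · obtain ⟨s, hs⟩ : ∃ s, s = (1 - B)⁻¹.mulVec (-g) := ⟨_, rfl⟩
    rw [← hs] at hstar ⊢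
    have hs' := (hfix s).2 hstar
    have herr : ∀ k, x k - s = (B ^ k).mulVec (x 0 - s) := fun k => by
      induction k with
      | zero => simp
      | succ k ih =>
        rw [pow_succ', ← Matrix.mulVec_mulVec, ← ih, Matrix.mulVec_sub, hx k]
        nth_rewrite 1 [hs']
        abel
    rw [← tendsto_sub_nhds_zero_iff]
    exact (Matrix.tendsto_pow_mulVec_zero hspec (x 0 - s)).congr fun k => (herr k).symm
end

section
/- Let W₁, W₂, T be symmetric positive definite real n×n matrices, A = (W₁ - W₂) + iT, M = -(1/i)(W₁ + iT) T^{-1} (W₂ - iT), and N = -(1/i) W₁ T^{-1} W₂. Then A = M - N and M^{-1} N = (W₂ - iT)^{-1} W₁ (W₁ + iT)^{-1} W₂. -/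
open Matrix in
/-- A complex matrix with positive definite real part and symmetric imaginary part is invertible. -/
theorem Matrix.PosDef.isUnit_det_cplx_add_I_smul_cplx {n : ℕ} {W S : Matrix (Fin n) (Fin n) ℝ}
    (hW : W.PosDef) (hS : S.IsSymm) : IsUnit (W.cplx + Complex.I • S.cplx).det := by
  rw [isUnit_iff_ne_zero]
  intro hdet
  obtain ⟨v, hv, hv0⟩ := Matrix.exists_mulVec_eq_zero_iff.mpr hdet
  set x : Fin n → ℝ := fun i => (v i).re with hx
  set y : Fin n → ℝ := fun i => (v i).im with hy
  have hre : W *ᵥ x = S *ᵥ y := by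
    ext i
    have h := congrArg Complex.re (congrFun hv0 i)
    simp [Matrix.cplx, Matrix.mulVec, dotProduct, Finset.sum_sub_distrib] at h
    simpa [Matrix.mulVec, dotProduct, hx, hy] using sub_eq_zero.mp h
  have him : W *ᵥ y = -(S *ᵥ x) := by
    ext i
    have h := congrArg Complex.im (congrFun hv0 i)
    simp [Matrix.cplx, Matrix.mulVec, dotProduct, Finset.sum_add_distrib] at h
    simpa [Matrix.mulVec, dotProduct, hx, hy] using eq_neg_of_add_eq_zero_left h
  have hsum : x ⬝ᵥ W *ᵥ x + y ⬝ᵥ W *ᵥ y = 0 := by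
    have hxy : x ⬝ᵥ S *ᵥ y = y ⬝ᵥ S *ᵥ x := by
      rw [dotProduct_mulVec, ← mulVec_transpose, hS.eq, dotProduct_comm]
    rw [hre, him, dotProduct_neg, hxy, add_neg_cancel]
  have hnonneg (z : Fin n → ℝ) : 0 ≤ z ⬝ᵥ W *ᵥ z := by
    simpa using hW.posSemidef.dotProduct_mulVec_nonneg z
  have hzero (z : Fin n → ℝ) (hz : z ⬝ᵥ W *ᵥ z = 0) : z = 0 := by
    by_contra hne
    have h := hW.dotProduct_mulVec_pos hne
    simp [hz] at h
  have hx0 := hzero x (by linarith [hnonneg x, hnonneg y])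
  have hy0 := hzero y (by linarith [hnonneg x, hnonneg y])
  exact hv (funext fun i => Complex.ext (congrFun hx0 i) (congrFun hy0 i))

theorem Matrix.PosDef.isUnit_det_cplx {n : ℕ} {W : Matrix (Fin n) (Fin n) ℝ}
    (hW : W.PosDef) : IsUnit W.cplx.det := by
  have h := hW.isUnit_det_cplx_add_I_smul_cplx (Matrix.isSymm_zero (n := Fin n) (α := ℝ))
  have h0 : (0 : Matrix (Fin n) (Fin n) ℝ).cplx = 0 := by ext; simp [Matrix.cplx]
  simpa [h0] using h

/-- The matrices `X * (X + c • T)⁻¹ * T` and `T * (X + c • T)⁻¹ * X` agree. -/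
theorem Matrix.mul_inv_add_smul_mul_comm {m R : Type*} [Fintype m] [DecidableEq m] [CommRing R]
    (X T : Matrix m m R) (c : R) (h : IsUnit (X + c • T).det) :
    X * (X + c • T)⁻¹ * T = T * (X + c • T)⁻¹ * X := by
  have h₁ := congrArg (· * T) (Matrix.mul_nonsing_inv _ h)
  have h₂ := congrArg (T * ·) (Matrix.nonsing_inv_mul _ h)
  simp only [add_mul, mul_add, smul_mul_assoc, mul_smul_comm, one_mul, mul_one,
    ← mul_assoc] at h₁ h₂
  exact add_right_cancel (h₁.trans h₂.symm)

/-- the splitting `A = M - N` underlying Method I, and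
`M⁻¹ N = (W₂ - iT)⁻¹ W₁ (W₁ + iT)⁻¹ W₂`. -/
theorem stmt_3 {n : ℕ} (W₁ W₂ T : Matrix (Fin n) (Fin n) ℝ)
    (hW₁ : W₁.PosDef) (hW₂ : W₂.PosDef) (hT : T.PosDef)
    (A M N : Matrix (Fin n) (Fin n) ℂ)
    (hA : A = (W₁.cplx - W₂.cplx) + Complex.I • T.cplx)
    (hM : M = (-(1 / Complex.I)) •
      ((W₁.cplx + Complex.I • T.cplx) * T.cplx⁻¹ * (W₂.cplx - Complex.I • T.cplx)))
    (hN : N = (-(1 / Complex.I)) • (W₁.cplx * T.cplx⁻¹ * W₂.cplx)) :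
    A = M - N ∧
    M⁻¹ * N = (W₂.cplx - Complex.I • T.cplx)⁻¹ * W₁.cplx *
      (W₁.cplx + Complex.I • T.cplx)⁻¹ * W₂.cplx := by
  have hTsymm : T.IsSymm := by simpa using hT.isHermitian
  have hTu := hT.isUnit_det_cplx
  have hPu := hW₁.isUnit_det_cplx_add_I_smul_cplx hTsymm
  have hQu : IsUnit (W₂.cplx - Complex.I • T.cplx).det := by
    have h := hW₂.isUnit_det_cplx_add_I_smul_cplx hTsymm.neg
    have hneg : (-T).cplx = -T.cplx := by ext; simp [Matrix.cplx]
    rwa [hneg, smul_neg, ← sub_eq_add_neg] at h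
  have hc : -(1 / Complex.I) = Complex.I := by simp
  rw [hc] at hM hN
  subst hA hM hN
  generalize W₁.cplx = X at *
  generalize W₂.cplx = Y at *
  generalize T.cplx = Z at *
  constructor
  · simp only [add_mul, mul_sub, smul_mul_assoc, mul_smul_comm, Matrix.mul_nonsing_inv _ hTu,
      Matrix.nonsing_inv_mul_cancel_right _ _ hTu, one_mul, smul_add, smul_sub, smul_smul,
      Complex.I_mul_I, mul_assoc, neg_smul, one_smul, smul_neg]
    abel
  · have hMu : IsUnit ((X + Complex.I • Z) * Z⁻¹ * (Y - Complex.I • Z)).det := by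
      rw [Matrix.det_mul, Matrix.det_mul]
      exact (hPu.mul (Matrix.isUnit_nonsing_inv_det _ hTu)).mul hQu
    have hcomm := Matrix.mul_inv_add_smul_mul_comm X Z Complex.I hPu
    have hswap : Z * (X + Complex.I • Z)⁻¹ * X * Z⁻¹ = X * (X + Complex.I • Z)⁻¹ := by
      rw [← hcomm, Matrix.mul_nonsing_inv_cancel_right _ _ hTu]
    have hinv : (Complex.I • ((X + Complex.I • Z) * Z⁻¹ * (Y - Complex.I • Z)))⁻¹ =
        Complex.I⁻¹ • ((Y - Complex.I • Z)⁻¹ * (Z * (X + Complex.I • Z)⁻¹)) := by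
      have h := Matrix.inv_smul' _ (Units.mk0 Complex.I Complex.I_ne_zero) hMu
      simp only [Units.smul_def, Units.val_mk0, Units.val_inv_eq_inv_val] at h
      rw [h, Matrix.mul_inv_rev, Matrix.mul_inv_rev, Matrix.nonsing_inv_nonsing_inv _ hTu]
    rw [hinv, smul_mul_smul_comm, inv_mul_cancel₀ Complex.I_ne_zero, one_smul]
    simpa only [mul_assoc] using congrArg (fun B => (Y - Complex.I • Z)⁻¹ * (B * Y)) hswap
end

section
/- Let K and M be symmetric real n×n matrices with K positive definite and M positive semidefinite, A = [[K, -ωM],[ωM, K]] and B = [[K, -ωM],[ωM, K + 2ωM]] for ω > 0. Then every eigenvalue λ of B^{-1}A is real and satisfies 1/2 ≤ λ ≤ 1. -/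
open Matrix ComplexOrder

theorem Matrix.PosSemidef.map_ofReal {m : Type*} [Fintype m] [DecidableEq m] {M : Matrix m m ℝ}
    (hM : M.PosSemidef) : (M.map Complex.ofReal).PosSemidef := by
  obtain ⟨S, rfl⟩ : ∃ S : Matrix m m ℝ, M = Sᴴ * S := by
    open scoped MatrixOrder Matrix.Norms.L2Operator in
    exact CStarAlgebra.nonneg_iff_eq_star_mul_self.mp hM.nonneg
  have h : (Sᴴ * S).map Complex.ofReal = (S.map Complex.ofReal)ᴴ * S.map Complex.ofReal := by
    rw [← conjTranspose_map _ (fun x => by simp)]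
    exact Matrix.map_mul (f := Complex.ofRealHom)
  rw [h]
  exact posSemidef_conjTranspose_mul_self _

theorem Matrix.PosDef.map_ofReal {m : Type*} [Fintype m] [DecidableEq m] {K : Matrix m m ℝ}
    (hK : K.PosDef) : (K.map Complex.ofReal).PosDef :=
  hK.posSemidef.map_ofReal.posDef_iff_isUnit.mpr (hK.isUnit.map Complex.ofRealHom.mapMatrix)

section PresbForm

variable {m : Type*} [Fintype m] {K W : Matrix m m ℂ} {x y : m → ℂ}

theorem Matrix.IsHermitian.star_dotProduct_mulVec_comm (hK : K.IsHermitian) (x y : m → ℂ) :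
    star x ⬝ᵥ K *ᵥ y = star (star y ⬝ᵥ K *ᵥ x) := by
  rw [← star_dotProduct, star_mulVec, hK.eq, dotProduct_mulVec]

theorem Matrix.IsHermitian.star_dotProduct_mulVec_eq_of_mulVec_eq (hK : K.IsHermitian)
    (hW : W.IsHermitian) (h : K *ᵥ x = W *ᵥ y) :
    star y ⬝ᵥ W *ᵥ x = star x ⬝ᵥ K *ᵥ x := by
  rw [hW.star_dotProduct_mulVec_comm, ← h, ← hK.star_dotProduct_mulVec_comm]

theorem Matrix.PosDef.add_star_dotProduct_mulVec_pos (hK : K.PosDef) (h : x ≠ 0 ∨ y ≠ 0) :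
    0 < star x ⬝ᵥ K *ᵥ x + star y ⬝ᵥ K *ᵥ y := by
  rcases h with h | h
  · exact add_pos_of_pos_of_nonneg (hK.dotProduct_mulVec_pos h)
      (hK.posSemidef.dotProduct_mulVec_nonneg y)
  · exact add_pos_of_nonneg_of_pos (hK.posSemidef.dotProduct_mulVec_nonneg x)
      (hK.dotProduct_mulVec_pos h)

/-- If `K x = W y`, then the form of `2 W` at `y` is dominated by the form of `K` at `x` and `y`. -/
theorem Matrix.PosSemidef.two_mul_star_dotProduct_mulVec_le (hK : K.PosSemidef)
    (hW : W.IsHermitian) (h : K *ᵥ x = W *ᵥ y) :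
    2 * (star y ⬝ᵥ W *ᵥ y) ≤ star x ⬝ᵥ K *ᵥ x + star y ⬝ᵥ K *ᵥ y := by
  have hyx : star y ⬝ᵥ K *ᵥ x = star y ⬝ᵥ W *ᵥ y := by rw [h]
  have hxy : star x ⬝ᵥ K *ᵥ y = star y ⬝ᵥ W *ᵥ y := by
    rw [hK.isHermitian.star_dotProduct_mulVec_comm, hyx, ← hW.star_dotProduct_mulVec_comm]
  have := hK.dotProduct_mulVec_nonneg (x - y)
  rw [star_sub, mulVec_sub, sub_dotProduct, dotProduct_sub, dotProduct_sub, hyx, hxy] at this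
  rw [← sub_nonneg]
  convert this using 1
  ring

end PresbForm

theorem isUnit_presb {m : Type*} [Fintype m] [DecidableEq m] {K W : Matrix m m ℂ}
    (hK : K.PosDef) (hW : W.PosSemidef) : IsUnit (fromBlocks K (-W) W (K + (2 : ℂ) • W)) := by
  rw [isUnit_iff_isUnit_det, isUnit_iff_ne_zero]
  intro hdet
  obtain ⟨v, hv, h⟩ := exists_mulVec_eq_zero_iff.mpr hdet
  obtain ⟨x, y, rfl⟩ : ∃ x y : m → ℂ, v = Sum.elim x y := ⟨_, _, (Sum.elim_comp_inl_inr v).symm⟩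
  rw [fromBlocks_mulVec, ← Sum.elim_zero_zero, Sum.elim_eq_iff] at h
  simp only [Sum.elim_comp_inl, Sum.elim_comp_inr, neg_mulVec, add_mulVec, smul_mulVec] at h
  have hxy : K *ᵥ x = W *ᵥ y := add_neg_eq_zero.mp h.1
  have hne : x ≠ 0 ∨ y ≠ 0 := by
    by_contra! hc
    exact hv (by rw [hc.1, hc.2, Sum.elim_zero_zero])
  have hpos := hK.add_star_dotProduct_mulVec_pos hne
  have hq := hW.dotProduct_mulVec_nonneg y
  have h2 := congrArg (star y ⬝ᵥ ·) h.2
  simp only [dotProduct_add, dotProduct_smul, dotProduct_zero, smul_eq_mul,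
    hK.isHermitian.star_dotProduct_mulVec_eq_of_mulVec_eq hW.isHermitian hxy] at h2
  rw [← add_assoc] at h2
  exact (add_pos_of_pos_of_nonneg hpos (mul_nonneg zero_le_two hq)).ne' h2

theorem presb_generalized_eigenvalue_mem {m : Type*} [Fintype m] {K W : Matrix m m ℂ}
    (hK : K.PosDef) (hW : W.PosSemidef) {lam : ℂ} {v : m ⊕ m → ℂ} (hv : v ≠ 0)
    (h : fromBlocks K (-W) W K *ᵥ v = lam • fromBlocks K (-W) W (K + (2 : ℂ) • W) *ᵥ v) :
    lam.im = 0 ∧ 1 / 2 ≤ lam.re ∧ lam.re ≤ 1 := by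
  by_cases hlam : lam = 1
  · norm_num [hlam]
  obtain ⟨x, y, rfl⟩ : ∃ x y : m → ℂ, v = Sum.elim x y := ⟨_, _, (Sum.elim_comp_inl_inr v).symm⟩
  have h₁ : K *ᵥ x - W *ᵥ y = lam • (K *ᵥ x - W *ᵥ y) := by
    ext i
    simpa [fromBlocks_mulVec, neg_mulVec, sub_eq_add_neg] using congrFun h (Sum.inl i)
  have h₂ : W *ᵥ x + K *ᵥ y = lam • (W *ᵥ x + (K *ᵥ y + (2 : ℂ) • W *ᵥ y)) := by
    ext i
    simpa [fromBlocks_mulVec, add_mulVec, smul_mulVec] using congrFun h (Sum.inr i)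
  have hxy : K *ᵥ x = W *ᵥ y := by
    have : (1 - lam) • (K *ᵥ x - W *ᵥ y) = 0 := by rw [sub_smul, one_smul, ← h₁, sub_self]
    exact sub_eq_zero.mp ((smul_eq_zero.mp this).resolve_left (sub_ne_zero.mpr (Ne.symm hlam)))
  have hne : x ≠ 0 ∨ y ≠ 0 := by
    by_contra! hc
    exact hv (by rw [hc.1, hc.2, Sum.elim_zero_zero])
  have hp := hK.add_star_dotProduct_mulVec_pos hne
  have hq := hW.dotProduct_mulVec_nonneg y
  have hpq := hK.posSemidef.two_mul_star_dotProduct_mulVec_le hW.isHermitian hxy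
  have h₃ := congrArg (star y ⬝ᵥ ·) h₂
  simp only [dotProduct_add, dotProduct_smul, smul_eq_mul,
    hK.isHermitian.star_dotProduct_mulVec_eq_of_mulVec_eq hW.isHermitian hxy] at h₃
  rw [← add_assoc] at h₃
  generalize star x ⬝ᵥ K *ᵥ x + star y ⬝ᵥ K *ᵥ y = p at *
  generalize star y ⬝ᵥ W *ᵥ y = q at *
  lift p to ℝ using (Complex.le_def.mp hp.le).2.symm
  lift q to ℝ using (Complex.le_def.mp hq).2.symm
  norm_cast at hp hq hpq
  have hpos : 0 < p + 2 * q := by positivity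
  have hlam' : lam = ((p / (p + 2 * q) : ℝ) : ℂ) := by
    rw [Complex.ofReal_div, eq_div_iff (Complex.ofReal_ne_zero.mpr hpos.ne')]
    push_cast
    exact h₃.symm
  rw [hlam', Complex.ofReal_im, Complex.ofReal_re, div_le_div_iff₀ two_pos hpos, div_le_one hpos]
  exact ⟨rfl, by linarith, by linarith⟩

/-- PRESB spectral inclusion: every eigenvalue of `B⁻¹A`, where
`A = [[K, -ωM],[ωM, K]]` and `B = [[K, -ωM],[ωM, K+2ωM]]`, is real and lies in
`[1/2, 1]`. -/
theorem stmt_12 {n : ℕ} (K M : Matrix (Fin n) (Fin n) ℝ)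
    (hK : K.PosDef) (hM : M.PosSemidef) (ω : ℝ) (hω : 0 < ω)
    (A B : Matrix (Fin n ⊕ Fin n) (Fin n ⊕ Fin n) ℝ)
    (hA : A = Matrix.fromBlocks K (-(ω • M)) (ω • M) K)
    (hB : B = Matrix.fromBlocks K (-(ω • M)) (ω • M) (K + (2 * ω) • M)) :
    ∀ lam ∈ spectrum ℂ ((B.map Complex.ofReal)⁻¹ * A.map Complex.ofReal),
      lam.im = 0 ∧ 1 / 2 ≤ lam.re ∧ lam.re ≤ 1 := by
  intro lam hlam
  have hKc := hK.map_ofReal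
  have hWc := (hM.smul hω.le).map_ofReal
  have hAc : A.map Complex.ofReal = fromBlocks (K.map Complex.ofReal)
      (-(ω • M).map Complex.ofReal) ((ω • M).map Complex.ofReal) (K.map Complex.ofReal) := by
    rw [hA, fromBlocks_map]
    congr 1
    ext i j
    simp
  have hBc : B.map Complex.ofReal = fromBlocks (K.map Complex.ofReal)
      (-(ω • M).map Complex.ofReal) ((ω • M).map Complex.ofReal)
      (K.map Complex.ofReal + (2 : ℂ) • (ω • M).map Complex.ofReal) := by
    rw [hB, fromBlocks_map]
    congr 1 <;> ext i j <;> simp [mul_assoc]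
  have hu := isUnit_presb hKc hWc
  rw [← hBc] at hu
  rw [← spectrum_toLin', ← Module.End.hasEigenvalue_iff_mem_spectrum] at hlam
  obtain ⟨v, hv⟩ := hlam.exists_hasEigenvector
  have h := hv.apply_eq_smul
  rw [toLin'_apply] at h
  refine presb_generalized_eigenvalue_mem hKc hWc hv.2 ?_
  rw [← hAc, ← hBc, ← mulVec_smul, ← h, mulVec_mulVec,
    mul_nonsing_inv_cancel_left _ _ ((isUnit_iff_isUnit_det _).mp hu)]
end

section
/- Let W₁, W₂, T be symmetric positive definite real n×n matrices and set A = (W₁ - W₂) + iT, M = -(1/i)(W₁ + iT) T^{-1}(W₂ - iT). Then M^{-1}A = I - B where B = (W₂ - iT)^{-1} W₁ (W₁ + iT)^{-1} W₂, and consequently every eigenvalue μ of the preconditioned matrix M^{-1}A satisfies |μ - 1| < 1; in particular M^{-1}A is invertible and its eigenvalues lie in the open disk of radius 1 centered at 1. -/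
open Matrix ComplexOrder in
theorem Matrix.PosDef.cplx {n : ℕ} {T : Matrix (Fin n) (Fin n) ℝ} (hT : T.PosDef) :
    T.cplx.PosDef := by
  have hsymm : Tᵀ = T := by simpa using hT.isHermitian.eq
  refine PosDef.of_dotProduct_mulVec_pos ?_ fun x hx => ?_
  · ext i j
    have h := congrFun (congrFun hsymm i) j
    simpa [Matrix.cplx] using h
  set a : Fin n → ℝ := fun i => (x i).re with ha
  set b : Fin n → ℝ := fun i => (x i).im with hb
  have hswap : ∑ i, ∑ j, a i * (T i j * b j) = ∑ i, ∑ j, b i * (T i j * a j) := by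
    rw [Finset.sum_comm]
    refine Finset.sum_congr rfl fun i _ => Finset.sum_congr rfl fun j _ => ?_
    have h := congrFun (congrFun hsymm i) j
    rw [transpose_apply] at h
    rw [h]
    ring
  have hform : star x ⬝ᵥ (T.cplx *ᵥ x) =
      ((a ⬝ᵥ (T *ᵥ a) + b ⬝ᵥ (T *ᵥ b) : ℝ) : ℂ) := by
    apply Complex.ext
    · simp [dotProduct, mulVec, Matrix.cplx, a, b]
      simp [Finset.sum_add_distrib]
    · simp only [dotProduct, mulVec, Finset.mul_sum, Complex.im_sum, Complex.ofReal_im]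
      have h : ∀ i j, (star x i * (T.cplx i j * x j)).im =
          a i * (T i j * b j) - b i * (T i j * a j) := by
        intro i j
        simp [Matrix.cplx, a, b]
        ring
      simp only [h, Finset.sum_sub_distrib]
      rw [hswap, sub_self]
  rw [hform, Complex.zero_lt_real]
  have hnonneg : ∀ y : Fin n → ℝ, 0 ≤ y ⬝ᵥ (T *ᵥ y) := fun y => by
    simpa using hT.posSemidef.dotProduct_mulVec_nonneg y
  have hpos : ∀ y : Fin n → ℝ, y ≠ 0 → 0 < y ⬝ᵥ (T *ᵥ y) := fun y hy => by
    simpa using hT.dotProduct_mulVec_pos hy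
  by_cases h : a = 0
  · have : b ≠ 0 := fun h' => hx <| funext fun i =>
      Complex.ext (congrFun h i) (congrFun h' i)
    linarith [hnonneg a, hpos b this]
  · linarith [hnonneg b, hpos a h]

section

variable {m : Type*} [Fintype m] [DecidableEq m]

open Matrix ComplexOrder

/-- The `T⁻¹`-weighted square norm of `(W + c T) u` for `c = ± i` has no cross term. -/
theorem Matrix.dotProduct_inv_mulVec_add_smul {W T : Matrix m m ℂ} (hW : W.IsHermitian)
    (hT : T.PosDef) {c : ℂ} (hc : star c = -c) (hc2 : c * c = -1) (u : m → ℂ) :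
    star ((W + c • T) *ᵥ u) ⬝ᵥ (T⁻¹ *ᵥ ((W + c • T) *ᵥ u)) =
      star (W *ᵥ u) ⬝ᵥ (T⁻¹ *ᵥ (W *ᵥ u)) + star u ⬝ᵥ (T *ᵥ u) := by
  have hdet : IsUnit T.det := (isUnit_iff_isUnit_det T).1 hT.isUnit
  have key : (W + c • T)ᴴ * T⁻¹ * (W + c • T) = Wᴴ * T⁻¹ * W + T := by
    rw [conjTranspose_add, conjTranspose_smul, hT.isHermitian.eq, hW.eq, hc]
    simp only [add_mul, mul_add, smul_mul_assoc, mul_smul_comm, mul_nonsing_inv _ hdet,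
      nonsing_inv_mul_cancel_right _ _ hdet, one_mul]
    rw [smul_add, smul_smul, mul_neg, hc2]
    module
  have h (X : Matrix m m ℂ) : star (X *ᵥ u) ⬝ᵥ (T⁻¹ *ᵥ (X *ᵥ u)) =
      star u ⬝ᵥ ((Xᴴ * T⁻¹ * X) *ᵥ u) := by
    rw [star_mulVec, ← dotProduct_mulVec]
    simp only [mulVec_mulVec, mul_assoc]
  rw [h, h, key, add_mulVec, dotProduct_add]

theorem Matrix.IsHermitian.isUnit_det_add_smul {W T : Matrix m m ℂ} (hW : W.IsHermitian)
    (hT : T.PosDef) {c : ℂ} (hc : star c = -c) (hc2 : c * c = -1) :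
    IsUnit (W + c • T).det := by
  rw [isUnit_iff_ne_zero]
  intro h0
  obtain ⟨u, hu, h⟩ := exists_mulVec_eq_zero_iff.2 h0
  have h1 := dotProduct_inv_mulVec_add_smul hW hT hc hc2 u
  rw [h, star_zero, zero_dotProduct] at h1
  have h2 := hT.dotProduct_mulVec_pos hu
  have h3 := hT.inv.posSemidef.dotProduct_mulVec_nonneg (W *ᵥ u)
  exact (add_pos_of_nonneg_of_pos h3 h2).ne h1

theorem Matrix.norm_lt_one_of_mulVec_eq_smul {W₁ W₂ T : Matrix m m ℂ} (hW₁ : W₁.IsHermitian)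
    (hW₂ : W₂.IsHermitian) (hT : T.PosDef) {c d : ℂ} (hc : star c = -c) (hc2 : c * c = -1)
    (hd : star d = -d) (hd2 : d * d = -1) {l : ℂ} {v : m → ℂ} (hv : v ≠ 0)
    (h : ((W₂ + d • T)⁻¹ * W₁ * (W₁ + c • T)⁻¹ * W₂) *ᵥ v = l • v) : ‖l‖ < 1 := by
  have hD₁ := hW₁.isUnit_det_add_smul hT hc hc2
  have hD₂ := hW₂.isUnit_det_add_smul hT hd hd2
  set u := ((W₁ + c • T)⁻¹ * W₂) *ᵥ v with hu
  have hu1 : (W₁ + c • T) *ᵥ u = W₂ *ᵥ v := by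
    rw [hu, mulVec_mulVec, mul_nonsing_inv_cancel_left _ _ hD₁]
  have hu2 : W₁ *ᵥ u = l • ((W₂ + d • T) *ᵥ v) := by
    rw [← mulVec_smul, ← h, hu, mulVec_mulVec, mulVec_mulVec]
    simp only [mul_assoc]
    rw [mul_nonsing_inv_cancel_left _ _ hD₂]
  have e1 := dotProduct_inv_mulVec_add_smul hW₁ hT hc hc2 u
  have e2 := dotProduct_inv_mulVec_add_smul hW₂ hT hd hd2 v
  rw [hu1, hu2, mulVec_smul, star_smul, smul_dotProduct, dotProduct_smul, e2, smul_smul] at e1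
  have hp := hT.inv.posSemidef.dotProduct_mulVec_nonneg (W₂ *ᵥ v)
  have hq := hT.dotProduct_mulVec_pos hv
  have hr := hT.posSemidef.dotProduct_mulVec_nonneg u
  have hl : star l * l = ((‖l‖ ^ 2 : ℝ) : ℂ) := by
    rw [Complex.star_def, Complex.conj_mul']
    norm_cast
  rw [hl] at e1
  have e := congrArg Complex.re e1
  rw [smul_eq_mul, Complex.add_re, Complex.re_ofReal_mul, Complex.add_re] at e
  have hp' := (Complex.le_def.1 hp).1
  have hq' := (Complex.lt_def.1 hq).1
  have hr' := (Complex.le_def.1 hr).1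
  rw [Complex.zero_re] at hp' hq' hr'
  by_contra! hcon
  have : 1 ≤ ‖l‖ ^ 2 := one_le_pow₀ hcon
  nlinarith

end

/-- `M⁻¹A = I - B` for the Method I preconditioner, so the eigenvalues
of `M⁻¹A` lie in the open disk of radius `1` centered at `1`, and `M⁻¹A` is invertible. -/
theorem stmt_14 {n : ℕ} (W₁ W₂ T : Matrix (Fin n) (Fin n) ℝ)
    (hW₁ : W₁.PosDef) (hW₂ : W₂.PosDef) (hT : T.PosDef)
    (A M B : Matrix (Fin n) (Fin n) ℂ)
    (hA : A = (W₁.cplx - W₂.cplx) + Complex.I • T.cplx)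
    (hM : M = (-(1 / Complex.I)) •
      ((W₁.cplx + Complex.I • T.cplx) * T.cplx⁻¹ * (W₂.cplx - Complex.I • T.cplx)))
    (hB : B = (W₂.cplx - Complex.I • T.cplx)⁻¹ * W₁.cplx *
      (W₁.cplx + Complex.I • T.cplx)⁻¹ * W₂.cplx) :
    M⁻¹ * A = 1 - B ∧
    (∀ mu ∈ spectrum ℂ (M⁻¹ * A), ‖mu - 1‖ < 1) ∧
    IsUnit (M⁻¹ * A) := by
  open ComplexOrder in
  have hP := hT.cplx
  have hW₁' := hW₁.cplx.isHermitian
  have hW₂' := hW₂.cplx.isHermitian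
  generalize W₁.cplx = V₁ at *
  generalize W₂.cplx = V₂ at *
  generalize T.cplx = S at *
  have hc : star Complex.I = -Complex.I := by simp
  have hc2 : Complex.I * Complex.I = -1 := Complex.I_mul_I
  have hd : star (-Complex.I) = -(-Complex.I) := by simp
  have hd2 : -Complex.I * -Complex.I = -1 := by simp
  have hS : IsUnit S.det := (Matrix.isUnit_iff_isUnit_det S).1 hP.isUnit
  have hD₁ := hW₁'.isUnit_det_add_smul hP hc hc2
  have hD₂ := hW₂'.isUnit_det_add_smul hP hd hd2
  rw [sub_eq_add_neg V₂, ← neg_smul] at hM hB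
  have hI : -(1 / Complex.I) = Complex.I := by simp
  rw [hI] at hM
  have hMdet : IsUnit M.det := by
    rw [hM, Matrix.det_smul, Matrix.det_mul, Matrix.det_mul]
    exact ((isUnit_iff_ne_zero.2 Complex.I_ne_zero).pow _).mul
      ((hD₁.mul (Matrix.isUnit_nonsing_inv_det _ hS)).mul hD₂)
  have hcomm : (V₁ + Complex.I • S) * S⁻¹ * V₁ = V₁ * S⁻¹ * (V₁ + Complex.I • S) := by
    simp only [add_mul, mul_add, smul_mul_assoc, mul_smul_comm, Matrix.mul_nonsing_inv _ hS,
      Matrix.nonsing_inv_mul_cancel_right _ _ hS, one_mul]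
  have hMB : M * B = Complex.I • (V₁ * S⁻¹ * V₂) := by
    rw [hM, hB, smul_mul_assoc]
    congr 1
    calc _ = (V₁ + Complex.I • S) * S⁻¹ * ((V₂ + -Complex.I • S) *
          ((V₂ + -Complex.I • S)⁻¹ * (V₁ * (V₁ + Complex.I • S)⁻¹ * V₂))) := by
          simp only [mul_assoc]
      _ = (V₁ + Complex.I • S) * S⁻¹ * V₁ * (V₁ + Complex.I • S)⁻¹ * V₂ := by
          rw [Matrix.mul_nonsing_inv_cancel_left _ _ hD₂]
          simp only [mul_assoc]
      _ = _ := by rw [hcomm, Matrix.mul_nonsing_inv_cancel_right _ _ hD₁]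
  have hMA : A = M * (1 - B) := by
    rw [mul_sub, mul_one, hMB, hM, hA]
    simp only [add_mul, mul_add, smul_mul_assoc, mul_smul_comm, Matrix.mul_nonsing_inv _ hS,
      Matrix.nonsing_inv_mul_cancel_right _ _ hS, one_mul, smul_add, smul_smul, mul_neg, hc2]
    simp only [neg_neg, one_smul, neg_mul, mul_one, hc2, neg_smul]
    module
  have hmain : M⁻¹ * A = 1 - B := by
    rw [hMA, Matrix.nonsing_inv_mul_cancel_left _ _ hMdet]
  have hspec : ∀ mu ∈ spectrum ℂ (M⁻¹ * A), ‖mu - 1‖ < 1 := by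
    intro mu hmu
    rw [hmain, spectrum.mem_iff, Matrix.isUnit_iff_isUnit_det, isUnit_iff_ne_zero, not_not] at hmu
    obtain ⟨v, hv, h⟩ := Matrix.exists_mulVec_eq_zero_iff.2 hmu
    rw [Algebra.algebraMap_eq_smul_one, Matrix.sub_mulVec, Matrix.sub_mulVec, Matrix.smul_mulVec,
      Matrix.one_mulVec] at h
    rw [norm_sub_rev]
    refine Matrix.norm_lt_one_of_mulVec_eq_smul hW₁' hW₂' hP hc hc2 hd hd2 hv ?_
    rw [← hB, sub_smul, one_smul]
    linear_combination h
  refine ⟨hmain, hspec, ?_⟩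
  by_contra h
  have := hspec 0 (spectrum.zero_mem ℂ h)
  simp at this
end
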